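/- For integers n ≥ 1, k > 1, l > 1, the Baumslag-Solitar groups BS(k, kn) and BS(l, ln) are abstractly commensurable. -/

import Mathlib

def AbstractlyCommensurable (G : Type*) (H : Type*) [Group G] [Group H] : Prop :=
  ∃ (A : Subgroup G) (B : Subgroup H), A.FiniteIndex ∧ B.FiniteIndex ∧ Nonempty (A ≃* B)

def BSRel (m n : ℤ) : Set (FreeGroup Bool) :=
  {(FreeGroup.of false)⁻¹ * FreeGroup.of true ^ m * FreeGroup.of false *
    (FreeGroup.of true ^ n)⁻¹}

abbrev BS (m n : ℤ) : Type := PresentedGroup (BSRel m n)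

/-- The relators `tᵢ bⁿ tᵢ⁻¹ b⁻¹` for `i : ι`, where `b` is the letter `none` and `tᵢ` is the
letter `some i`. -/
def multiBSRel (ι : Type) (n : ℤ) : Set (FreeGroup (Option ι)) :=
  Set.range fun i => FreeGroup.of (some i) * FreeGroup.of none ^ n *
    (FreeGroup.of none * FreeGroup.of (some i))⁻¹

/-- The multiple HNN extension `⟨b, tᵢ (i : ι) ∣ tᵢ⁻¹ b tᵢ = bⁿ⟩`. -/
abbrev MultiBS (ι : Type) (n : ℤ) : Type := PresentedGroup (multiBSRel ι n)

namespace MultiBS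

variable {ι κ : Type} {n : ℤ}

/-- The generator of the base group. -/
def base (ι : Type) (n : ℤ) : MultiBS ι n := PresentedGroup.of none

/-- The stable letters. -/
def stable (n : ℤ) (i : ι) : MultiBS ι n := PresentedGroup.of (some i)

theorem semiconjBy_stable (i : ι) :
    SemiconjBy (stable n i) (base ι n ^ n) (base ι n) := by
  have h := PresentedGroup.one_of_mem (rels := multiBSRel ι n) ⟨i, rfl⟩
  simp only [map_mul, map_inv, map_zpow] at h
  exact mul_inv_eq_one.mp h

/-- The universal property of `MultiBS`. -/
def lift {G : Type*} [Group G] (c : G) (x : ι → G) (h : ∀ i, SemiconjBy (x i) (c ^ n) c) :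
    MultiBS ι n →* G :=
  PresentedGroup.toGroup (f := fun o => o.elim c x) (by
    rintro _ ⟨i, rfl⟩
    simp only [map_mul, map_inv, map_zpow, FreeGroup.lift_apply_of]
    exact mul_inv_eq_one.mpr (h i).eq)

section lift

variable {G : Type*} [Group G] (c : G) (x : ι → G) (h : ∀ i, SemiconjBy (x i) (c ^ n) c)

@[simp] theorem lift_base : lift c x h (base ι n) = c := PresentedGroup.toGroup.of _

@[simp] theorem lift_stable (i : ι) : lift c x h (stable n i) = x i :=
  PresentedGroup.toGroup.of _

end lift

theorem hom_ext {G : Type*} [Group G] {f g : MultiBS ι n →* G}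
    (hb : f (base ι n) = g (base ι n)) (hs : ∀ i, f (stable n i) = g (stable n i)) : f = g :=
  PresentedGroup.ext fun o => by
    cases o with
    | none => exact hb
    | some i => exact hs i

theorem closure_eq_top :
    Subgroup.closure (insert (base ι n) (Set.range (stable n))) = ⊤ := by
  rw [← PresentedGroup.closure_range_of (multiBSRel ι n)]
  congr 1
  ext y
  simp [base, stable, Option.exists, eq_comm]

/-- Reindexing the stable letters. -/
def congr (n : ℤ) (e : ι ≃ κ) : MultiBS ι n ≃* MultiBS κ n :=
  MonoidHom.toMulEquiv
    (lift (base κ n) (fun i => stable n (e i)) fun _ => semiconjBy_stable _)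
    (lift (base ι n) (fun i => stable n (e.symm i)) fun _ => semiconjBy_stable _)
    (hom_ext (by simp) (by simp)) (hom_ext (by simp) (by simp))

end MultiBS

namespace BS

/-- The generator `a`. -/
def a (m n : ℤ) : BS m n := PresentedGroup.of true

/-- The generator `t`. -/
def t (m n : ℤ) : BS m n := PresentedGroup.of false

theorem semiconjBy_t (m n : ℤ) : SemiconjBy (t m n) (a m n ^ n) (a m n ^ m) := by
  have h := PresentedGroup.one_of_mem (rels := BSRel m n) rfl
  simp only [map_mul, map_inv, map_zpow] at h
  have h' : (t m n)⁻¹ * a m n ^ m * t m n = a m n ^ n := mul_inv_eq_one.mp h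
  rw [SemiconjBy, ← h']
  group

/-- The universal property of `BS m n`. -/
def lift {m n : ℤ} {G : Type*} [Group G] (x y : G) (h : SemiconjBy y (x ^ n) (x ^ m)) :
    BS m n →* G :=
  PresentedGroup.toGroup (f := fun o => bif o then x else y) (by
    rintro _ rfl
    have h' := h.eq
    simp only [map_mul, map_inv, map_zpow, FreeGroup.lift_apply_of, cond_true, cond_false]
    rw [mul_inv_eq_one, mul_assoc, ← h', inv_mul_cancel_left])

section lift

variable {m n : ℤ} {G : Type*} [Group G] (x y : G) (h : SemiconjBy y (x ^ n) (x ^ m))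

@[simp] theorem lift_a : lift x y h (a m n) = x := PresentedGroup.toGroup.of _

@[simp] theorem lift_t : lift x y h (t m n) = y := PresentedGroup.toGroup.of _

end lift

theorem closure_eq_top (m n : ℤ) : Subgroup.closure {a m n, t m n} = ⊤ := by
  rw [← PresentedGroup.closure_range_of (BSRel m n)]
  congr 1
  ext y
  simp [a, t, or_comm]

end BS

/-- A subgroup is of finite index as soon as a finite family of representatives is permuted, modulo
the subgroup, by a generating set. -/
theorem Subgroup.finiteIndex_of_permuted_reps {G ι : Type*} [Group G] [Finite ι]
    (R : Subgroup G) (S : Set G) (hS : Subgroup.closure S = ⊤) (r : ι → G) (i₀ : ι)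
    (hr : r i₀ = 1)
    (h : ∀ s ∈ S, ∃ σ : Equiv.Perm ι, ∀ i, (r (σ i))⁻¹ * s * r i ∈ R) : R.FiniteIndex := by
  have key : ∀ g : G, ∃ σ : Equiv.Perm ι, ∀ i, (r (σ i))⁻¹ * g * r i ∈ R := by
    intro g
    have hg : g ∈ Subgroup.closure S := hS ▸ Subgroup.mem_top g
    induction hg using Subgroup.closure_induction with
    | mem s hs => exact h s hs
    | one => exact ⟨1, fun i => by simp⟩
    | mul x y _ _ hx hy =>
      obtain ⟨σ, hσ⟩ := hx
      obtain ⟨τ, hτ⟩ := hy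
      refine ⟨σ * τ, fun i => ?_⟩
      have := R.mul_mem (hσ (τ i)) (hτ i)
      simpa [mul_assoc] using this
    | inv x _ hx =>
      obtain ⟨σ, hσ⟩ := hx
      refine ⟨σ⁻¹, fun i => ?_⟩
      have := R.inv_mem (hσ (σ⁻¹ i))
      simpa [mul_assoc] using this
  have hsurj : Function.Surjective fun i => (r i : G ⧸ R) := by
    intro q
    obtain ⟨g, rfl⟩ := QuotientGroup.mk_surjective q
    obtain ⟨σ, hσ⟩ := key g
    refine ⟨σ i₀, QuotientGroup.eq.mpr ?_⟩
    simpa [hr] using hσ i₀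
  have := Finite.of_surjective _ hsurj
  exact Subgroup.finiteIndex_of_finite_quotient

theorem pow_succ_mul_inv_pow_succ {G : Type*} [Group G] (x y : G) (j : ℕ) :
    x ^ (j + 1) * (y ^ (j + 1))⁻¹ = x * (x ^ j * (y ^ j)⁻¹) * y⁻¹ := by
  rw [pow_succ' x, pow_succ' y, mul_inv_rev]
  simp only [mul_assoc]

/-- If `x` and `y` conjugate `c` to the same element, then `xʲ y⁻ʲ` commutes with `c`. -/
theorem SemiconjBy.commute_pow_mul_inv_pow {G : Type*} [Group G] {x y c : G} {n : ℤ}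
    (hx : SemiconjBy x (c ^ n) c) (hy : SemiconjBy y (c ^ n) c) (j : ℕ) :
    Commute (x ^ j * (y ^ j)⁻¹) c := by
  induction j with
  | zero => simp
  | succ j ih =>
    rw [pow_succ_mul_inv_pow_succ]
    exact (hx.mul_left (ih.zpow_right n)).mul_left hy.inv_symm_left

namespace BS

variable (P Q : ℕ) (n : ℤ)

/-- The type of stable letters of the finite index subgroup. -/
abbrev Letters : Type := Option (Fin (P + 1) × Fin (Q + 1))

/-- The index type of the cosets of the finite index subgroup. -/
abbrev Cosets : Type := Fin (P + 2) × Fin (Q + 1)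

/-- The stable letter by which `t` acts on a coset. -/
def letter (x : Cosets P Q) : Letters P Q :=
  Fin.lastCases (motive := fun _ => Letters P Q)
    (if x.2 = Fin.last Q then none else some (0, 0)) (fun i => some (i, x.2)) x.1

/-- The permutation of the cosets induced by `a`. -/
def permA : Equiv.Perm (Cosets P Q) := Equiv.prodCongr (finRotate (P + 2)) (Equiv.refl _)

/-- The permutation of the cosets induced by `t`. -/
def permT : Equiv.Perm (Cosets P Q) :=
  Equiv.prodShear (Equiv.refl _)
    fun i => if i = Fin.last (P + 1) then finRotate (Q + 1) else Equiv.refl _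

/-- The action of `a` on `Cosets × MultiBS`. -/
def actA : Equiv.Perm (Cosets P Q × MultiBS (Letters P Q) n) :=
  Equiv.prodShear (permA P Q) fun x =>
    if x.1 = Fin.last (P + 1) then Equiv.mulLeft (MultiBS.base _ n) else Equiv.refl _

/-- The action of `t` on `Cosets × MultiBS`. -/
def actT : Equiv.Perm (Cosets P Q × MultiBS (Letters P Q) n) :=
  Equiv.prodShear (permT P Q) fun x => Equiv.mulLeft (MultiBS.stable n (letter P Q x))

variable {P Q n} in
theorem actT_apply (x : Cosets P Q) (g : MultiBS (Letters P Q) n) :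
    actT P Q n (x, g) = (permT P Q x, MultiBS.stable n (letter P Q x) * g) := rfl

@[simp] theorem permT_castSucc (i : Fin (P + 1)) (j : Fin (Q + 1)) :
    permT P Q (i.castSucc, j) = (i.castSucc, j) := by
  simp [permT, Equiv.prodShear, Fin.castSucc_ne_last]

@[simp] theorem letter_castSucc (i : Fin (P + 1)) (j : Fin (Q + 1)) :
    letter P Q (i.castSucc, j) = some (i, j) := by
  simp [letter]

@[simp] theorem permT_last_castSucc (j : Fin Q) :
    permT P Q (Fin.last _, j.castSucc) = (Fin.last _, j.succ) := by
  simp [permT, Equiv.prodShear]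

@[simp] theorem letter_last_castSucc (j : Fin Q) :
    letter P Q (Fin.last _, j.castSucc) = some (0, 0) := by
  simp [letter, Fin.castSucc_ne_last]

@[simp] theorem permT_last_last :
    permT P Q (Fin.last _, Fin.last _) = (Fin.last _, 0) := by
  simp [permT, Equiv.prodShear]

@[simp] theorem letter_last_last : letter P Q (Fin.last _, Fin.last _) = none := by
  simp [letter]

/-- The fibrewise action of `MultiBS` by left multiplication. -/
def fibreAct : MultiBS (Letters P Q) n →*
    Equiv.Perm (Cosets P Q × MultiBS (Letters P Q) n) where
  toFun g := Equiv.prodCongr (Equiv.refl _) (Equiv.mulLeft g)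
  map_one' := by ext x <;> simp
  map_mul' g h := by ext x <;> simp [mul_assoc]

variable {P Q n}

theorem fibreAct_apply (h : MultiBS (Letters P Q) n) (x : Cosets P Q)
    (g : MultiBS (Letters P Q) n) : fibreAct P Q n h (x, g) = (x, h * g) := rfl

theorem actA_pow_apply (j : Fin (Q + 1)) (g : MultiBS (Letters P Q) n) (i : Fin (P + 2)) :
    (actA P Q n ^ (i : ℕ)) ((0, j), g) = ((i, j), g) := by
  induction i using Fin.induction with
  | zero => simp
  | succ i ih =>
    simp only [Fin.val_castSucc] at ih
    rw [Fin.val_succ, pow_succ', Equiv.Perm.mul_apply, ih]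
    simp [actA, permA, Equiv.prodShear, Fin.castSucc_ne_last]

theorem actA_pow_card : actA P Q n ^ (P + 2) = fibreAct P Q n (MultiBS.base _ n) := by
  ext1 ⟨⟨i, j⟩, g⟩
  have h0 (g) : (actA P Q n ^ (P + 2)) ((0, j), g) = ((0, j), MultiBS.base _ n * g) := by
    rw [pow_succ', Equiv.Perm.mul_apply]
    have := actA_pow_apply j g (Fin.last (P + 1))
    rw [Fin.val_last] at this
    rw [this]
    simp [actA, permA, Equiv.prodShear]
  rw [← actA_pow_apply j g i, ← Equiv.Perm.mul_apply, ← pow_add, add_comm, pow_add,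
    Equiv.Perm.mul_apply, h0, actA_pow_apply, actA_pow_apply]
  rfl

theorem semiconjBy_actT : SemiconjBy (actT P Q n)
    (fibreAct P Q n (MultiBS.base _ n) ^ n) (fibreAct P Q n (MultiBS.base _ n)) := by
  rw [← map_zpow]
  ext1 ⟨x, g⟩
  simp only [Equiv.Perm.mul_apply, actT_apply, fibreAct_apply, ← mul_assoc,
    (MultiBS.semiconjBy_stable (letter P Q x)).eq]

/-- `BS k (k * n)` with `k = P + 2`. -/
abbrev Source (P : ℕ) (n : ℤ) : Type := BS ((P + 2 : ℕ) : ℤ) ((P + 2 : ℕ) * n)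

variable (P Q n) in
/-- The action of `BS k (k * n)` on `Cosets × MultiBS`. -/
def act : Source P n →* Equiv.Perm (Cosets P Q × MultiBS (Letters P Q) n) :=
  lift (actA P Q n) (actT P Q n) (by
    rw [zpow_mul, zpow_natCast, actA_pow_card]
    exact semiconjBy_actT)

variable (P n) in
/-- The generator `a` of `BS k (k * n)`. -/
def genA : Source P n := a _ _

variable (P n) in
/-- The generator `t` of `BS k (k * n)`. -/
def genT : Source P n := t _ _

theorem semiconjBy_genT :
    SemiconjBy (genT P n) ((genA P n ^ (P + 2)) ^ n) (genA P n ^ (P + 2)) := by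
  simpa only [genA, genT, zpow_mul, zpow_natCast] using semiconjBy_t ((P + 2 : ℕ) : ℤ) ((P + 2 : ℕ) * n)

variable (P n) in
/-- The conjugate of `t` moving the base coset of one column to that of the next. -/
def shift : Source P n := (genA P n ^ (P + 1))⁻¹ * genT P n * genA P n ^ (P + 1)

theorem semiconjBy_shift :
    SemiconjBy (shift P n) ((genA P n ^ (P + 2)) ^ n) (genA P n ^ (P + 2)) := by
  have hA (u v : ℕ) : Commute (genA P n ^ u) (genA P n ^ v) := Commute.pow_pow_self _ _ _
  exact ((hA _ _).inv_left.semiconjBy.mul_left semiconjBy_genT).mul_left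
    ((hA _ _).zpow_right n).semiconjBy

/-- Representatives of the cosets. -/
def rep (x : Cosets P Q) : Source P n :=
  genA P n ^ (x.1 : ℕ) * (shift P n ^ (x.2 : ℕ) * (genT P n ^ (x.2 : ℕ))⁻¹)

theorem commute_rep (x : Cosets P Q) : Commute (rep (n := n) x) (genA P n ^ (P + 2)) :=
  (Commute.pow_pow_self _ _ _).mul_left
    (semiconjBy_shift.commute_pow_mul_inv_pow semiconjBy_genT _)

theorem semiconjBy_conj (x y : Cosets P Q) :
    SemiconjBy ((rep y)⁻¹ * genT P n * rep x) ((genA P n ^ (P + 2)) ^ n) (genA P n ^ (P + 2)) :=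
  ((commute_rep y).inv_left.semiconjBy.mul_left semiconjBy_genT).mul_left
    ((commute_rep x).zpow_right n).semiconjBy

variable (P Q n) in
/-- The embedding of `MultiBS` into `BS k (k * n)` as a finite index subgroup. -/
def embed : MultiBS (Letters P Q) n →* Source P n :=
  MultiBS.lift (genA P n ^ (P + 2))
    (fun o => o.elim
      ((rep (Q := Q) (Fin.last _, 0))⁻¹ * genT P n * rep (Q := Q) (Fin.last _, Fin.last _))
      fun x => (rep (x.1.castSucc, x.2))⁻¹ * genT P n * rep (x.1.castSucc, x.2))
    (by rintro (_ | x) <;> exact semiconjBy_conj _ _)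

theorem rep_zero : rep (n := n) (0 : Cosets P Q) = 1 := by simp [rep]

theorem embed_letter (x : Cosets P Q) :
    embed P Q n (MultiBS.stable n (letter P Q x)) =
      (rep (permT P Q x))⁻¹ * genT P n * rep x := by
  obtain ⟨i, j⟩ := x
  induction i using Fin.lastCases with
  | cast i => simp [embed]
  | last =>
    induction j using Fin.lastCases with
    | last => simp [embed]
    | cast j =>
      rw [letter_last_castSucc, permT_last_castSucc]
      have h : embed P Q n (MultiBS.stable n (some (0, 0))) = genT P n := by
        rw [embed, MultiBS.lift_stable]
        change (rep 0)⁻¹ * genT P n * rep 0 = _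
        simp [rep_zero]
      rw [h, eq_comm, mul_assoc, inv_mul_eq_iff_eq_mul]
      simp only [rep, Fin.val_succ, pow_succ_mul_inv_pow_succ]
      simp [shift, mul_assoc]

theorem act_genA : act P Q n (genA P n) = actA P Q n := lift_a _ _ _

theorem act_genT : act P Q n (genT P n) = actT P Q n := lift_t _ _ _

theorem act_rep (x : Cosets P Q) (g : MultiBS (Letters P Q) n) :
    act P Q n (rep x) (0, g) = (x, g) := by
  obtain ⟨i, j⟩ := x
  have hcol : act P Q n (shift P n ^ (j : ℕ) * (genT P n ^ (j : ℕ))⁻¹) (0, g) = ((0, j), g) := by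
    induction j using Fin.induction generalizing g with
    | zero => simp; rfl
    | succ j ih =>
      have hT : (actT P Q n)⁻¹ (0, g) = (0, (MultiBS.stable n (some (0, 0)))⁻¹ * g) := by
        rw [Equiv.Perm.inv_eq_iff_eq, show (0 : Cosets P Q) = (Fin.castSucc 0, 0) from rfl,
          actT_apply, permT_castSucc, letter_castSucc, mul_inv_cancel_left]
      have hA := actA_pow_apply (P := P) (Q := Q) (n := n) (i := Fin.last _)
      rw [Fin.val_last] at hA
      rw [Fin.val_succ, pow_succ_mul_inv_pow_succ, map_mul, map_mul, map_inv, act_genT,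
        Equiv.Perm.mul_apply, hT, Equiv.Perm.mul_apply]
      rw [Fin.val_castSucc] at ih
      rw [ih]
      simp only [shift, map_mul, map_inv, map_pow, act_genA, act_genT, Equiv.Perm.mul_apply]
      rw [hA, actT_apply, permT_last_castSucc, letter_last_castSucc, mul_inv_cancel_left,
        Equiv.Perm.inv_eq_iff_eq, hA]
  rw [rep, map_mul, Equiv.Perm.mul_apply, hcol, map_pow, act_genA, actA_pow_apply]

theorem act_conj (x : Cosets P Q) (g : MultiBS (Letters P Q) n) :
    act P Q n ((rep (permT P Q x))⁻¹ * genT P n * rep x) (0, g) =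
      (0, MultiBS.stable n (letter P Q x) * g) := by
  rw [map_mul, map_mul, map_inv, Equiv.Perm.mul_apply, act_rep, Equiv.Perm.mul_apply, act_genT,
    actT_apply, Equiv.Perm.inv_eq_iff_eq, act_rep]

theorem letter_surjective : Function.Surjective (letter P Q) := by
  rintro (_ | ⟨i, j⟩)
  · exact ⟨_, letter_last_last P Q⟩
  · exact ⟨_, letter_castSucc P Q i j⟩

theorem act_embed (h g : MultiBS (Letters P Q) n) :
    act P Q n (embed P Q n h) (0, g) = (0, h * g) := by
  have hh : h ∈ Subgroup.closure _ := MultiBS.closure_eq_top.symm ▸ Subgroup.mem_top h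
  induction hh using Subgroup.closure_induction generalizing g with
  | one => simp
  | mul x y _ _ hx hy => simp [hx, hy, mul_assoc]
  | inv x _ hx => rw [map_inv, map_inv, Equiv.Perm.inv_eq_iff_eq, hx, mul_inv_cancel_left]
  | mem s hs =>
    obtain rfl | ⟨i, rfl⟩ := hs
    · rw [embed, MultiBS.lift_base, map_pow, act_genA, actA_pow_card]
      rfl
    · obtain ⟨x, rfl⟩ := letter_surjective i
      rw [embed_letter, act_conj]

theorem embed_injective : Function.Injective (embed P Q n) := by
  rw [injective_iff_map_eq_one]
  intro h hh
  have := act_embed h 1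
  rw [hh] at this
  simpa using this.symm

theorem finiteIndex_range_embed : (embed P Q n).range.FiniteIndex := by
  refine Subgroup.finiteIndex_of_permuted_reps _ _ (closure_eq_top _ _) (rep (Q := Q)) 0
    rep_zero ?_
  rintro s (rfl | rfl)
  · refine ⟨permA P Q, fun ⟨i, j⟩ => ?_⟩
    induction i using Fin.lastCases with
    | cast i =>
      have h : permA P Q (i.castSucc, j) = (i.succ, j) := by simp [permA]
      refine ⟨1, ?_⟩
      rw [map_one, eq_comm, mul_assoc, inv_mul_eq_one, h]
      simp only [rep, Fin.val_succ, Fin.val_castSucc, pow_succ', mul_assoc]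
      rfl
    | last =>
      have h : permA P Q (Fin.last _, j) = (0, j) := by simp [permA]
      refine ⟨MultiBS.base _ n, ?_⟩
      rw [embed, MultiBS.lift_base, eq_comm, mul_assoc, inv_mul_eq_iff_eq_mul, h,
        (commute_rep _).eq]
      simp only [rep, Fin.val_last, Fin.val_zero, pow_zero, one_mul, pow_succ' _ (P + 1),
        mul_assoc]
      rfl
  · exact ⟨permT P Q, fun x => ⟨_, embed_letter x⟩⟩

end BS

theorem BS_ascending_commensurable (n k l : ℤ)
    (hn : 1 ≤ n) (hk : 1 < k) (hl : 1 < l) :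
    AbstractlyCommensurable (BS k (k * n)) (BS l (l * n)) := by
  obtain ⟨P, rfl⟩ : ∃ P : ℕ, k = ((P + 2 : ℕ) : ℤ) := ⟨(k - 2).toNat, by omega⟩
  obtain ⟨Q, rfl⟩ : ∃ Q : ℕ, l = ((Q + 2 : ℕ) : ℤ) := ⟨(l - 2).toNat, by omega⟩
  refine ⟨(BS.embed P Q n).range, (BS.embed Q P n).range, BS.finiteIndex_range_embed,
    BS.finiteIndex_range_embed, ⟨?_⟩⟩
  exact (MonoidHom.ofInjective BS.embed_injective).symm.trans
    ((MultiBS.congr n (Equiv.prodComm _ _).optionCongr).trans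
      (MonoidHom.ofInjective BS.embed_injective))
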